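/- Assume the BV function x:[0,T]→ℝ is continuous and satisfies the strong local stability and the energy-dissipation upper bound. Let t ∈ int([0,T]∖int(N)) with ∂ₓₓ𝓔(t,x(t)) = 0 and ∂ₓₓₓ𝓔(t,x(t)) ≠ 0. Then the one-sided derivatives x'₊(t) and x'₋(t) exist and are solutions X of the quadratic equation ∂ₓₜₜ𝓔(t,x(t)) + 2∂ₓₓₜ𝓔(t,x(t))·X + ∂ₓₓₓ𝓔(t,x(t))·X² = 0. Moreover, if t is an accumulation point of E := {s∈(0,T) : ∂ₓₓ𝓔(s,x(s)) = 0}, then x'(t) exists, equals −∂ₓₓₜ𝓔(t,x(t))/∂ₓₓₓ𝓔(t,x(t)), and is the unique solution of this quadratic equation; while if t is an isolated point of E, then either x'(t) = −∂ₓₓₜ𝓔(t,x(t))/∂ₓₓₓ𝓔(t,x(t)), or x'₊(t) = lim_{s↓t} x'(s) and x'₋(t) = lim_{s↑t} x'(s). -/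

import Mathlib

open Set Filter Topology MeasureTheory

/-- Dissipation of `x` on `[t₁,t₂]`: total variation of `x` on the interval. -/
noncomputable def Diss (x : ℝ → ℝ) (t₁ t₂ : ℝ) : ℝ :=
  (eVariationOn x (Set.Icc t₁ t₂)).toReal

/-- ∂ₓ𝓔 -/
noncomputable def pEx (E : ℝ → ℝ → ℝ) (t y : ℝ) : ℝ := deriv (fun z => E t z) y
/-- ∂ₜ𝓔 -/
noncomputable def pEt (E : ℝ → ℝ → ℝ) (t y : ℝ) : ℝ := deriv (fun s => E s y) t
/-- ∂ₓₓ𝓔 -/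
noncomputable def pExx (E : ℝ → ℝ → ℝ) (t y : ℝ) : ℝ := deriv (fun z => pEx E t z) y
/-- ∂ₓₓₓ𝓔 -/
noncomputable def pExxx (E : ℝ → ℝ → ℝ) (t y : ℝ) : ℝ := deriv (fun z => pExx E t z) y
/-- ∂ₓₜ𝓔 -/
noncomputable def pExt (E : ℝ → ℝ → ℝ) (t y : ℝ) : ℝ := deriv (fun s => pEx E s y) t
/-- ∂ₓₓₜ𝓔 -/
noncomputable def pExxt (E : ℝ → ℝ → ℝ) (t y : ℝ) : ℝ := deriv (fun s => pExx E s y) t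
/-- ∂ₓₜₜ𝓔 -/
noncomputable def pExtt (E : ℝ → ℝ → ℝ) (t y : ℝ) : ℝ := deriv (fun s => pExt E s y) t

/-- The jump set of `x` on `[0,T]`: points of discontinuity. -/
def JumpSet (x : ℝ → ℝ) (T : ℝ) : Set ℝ :=
  {t ∈ Set.Icc 0 T | ¬ ContinuousWithinAt x (Set.Icc 0 T) t}

/-- N := {t ∈ (0,T) : x'(t) exists and equals 0}. -/
def NullSet (x : ℝ → ℝ) (T : ℝ) : Set ℝ :=
  {t ∈ Set.Ioo 0 T | HasDerivAt x 0 t}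

/-- Weak local stability: |∂ₓ𝓔(t,x(t))| ≤ 1 at every continuity point of x in [0,T]. -/
def WeakLS (E : ℝ → ℝ → ℝ) (x : ℝ → ℝ) (T : ℝ) : Prop :=
  ∀ t ∈ Set.Icc 0 T, ContinuousWithinAt x (Set.Icc 0 T) t → |pEx E t (x t)| ≤ 1

/-- Strong local stability: x(t) local minimizer of z ↦ 𝓔(t,z)+|z−x(t)| off the jump set. -/
def StrongLS (E : ℝ → ℝ → ℝ) (x : ℝ → ℝ) (T : ℝ) : Prop :=
  ∀ t ∈ Set.Icc 0 T \ JumpSet x T, IsLocalMin (fun z => E t z + |z - x t|) (x t)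

/-- Energy-dissipation upper bound. -/
def EDUB (E : ℝ → ℝ → ℝ) (x : ℝ → ℝ) (T : ℝ) : Prop :=
  ∀ t₁ t₂ : ℝ, 0 ≤ t₁ → t₁ ≤ t₂ → t₂ ≤ T →
    E t₂ (x t₂) - E t₁ (x t₁) ≤ (∫ s in t₁..t₂, pEt E s (x s)) - Diss x t₁ t₂

/-- (H1): {(t,x) ∈ (0,T)×ℝ : ∂ₓ𝓔 ∈ {−1,1}, ∂ₓₓ𝓔 = ∂ₓₓₓ𝓔 = 0} is finite. -/
def H1cond (E : ℝ → ℝ → ℝ) (T : ℝ) : Prop :=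
  {p : ℝ × ℝ | p.1 ∈ Set.Ioo 0 T ∧ (pEx E p.1 p.2 = -1 ∨ pEx E p.1 p.2 = 1) ∧
    pExx E p.1 p.2 = 0 ∧ pExxx E p.1 p.2 = 0}.Finite

/-- (H2). -/
def H2cond (E : ℝ → ℝ → ℝ) (T : ℝ) : Prop :=
  {p : ℝ × ℝ | p.1 ∈ Set.Ioo 0 T ∧ (pEx E p.1 p.2 = -1 ∨ pEx E p.1 p.2 = 1) ∧
    pExx E p.1 p.2 = 0 ∧ pExt E p.1 p.2 = 0 ∧
    (pExxt E p.1 p.2) ^ 2 = pExtt E p.1 p.2 * pExxx E p.1 p.2}.Finite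

/-- (H3). -/
def H3cond (E : ℝ → ℝ → ℝ) (T : ℝ) : Prop :=
  {p : ℝ × ℝ | p.1 ∈ Set.Ioo 0 T ∧ (pEx E p.1 p.2 = -1 ∨ pEx E p.1 p.2 = 1) ∧
    pExx E p.1 p.2 = 0 ∧ pExt E p.1 p.2 = 0}.Finite

/-- (H4). -/
def H4cond (E : ℝ → ℝ → ℝ) (T : ℝ) : Prop :=
  {p : ℝ × ℝ | p.1 ∈ Set.Icc 0 T ∧ (pEx E p.1 p.2 = -1 ∨ pEx E p.1 p.2 = 1) ∧
    pExt E p.1 p.2 = 0 ∧ pExtt E p.1 p.2 = 0} = ∅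

/-- (H5). -/
def H5cond (E : ℝ → ℝ → ℝ) (T : ℝ) : Prop :=
  {p : ℝ × ℝ | p.1 ∈ Set.Icc 0 T ∧ (pEx E p.1 p.2 = -1 ∨ pEx E p.1 p.2 = 1) ∧
    pExx E p.1 p.2 = 0} = ∅

section PartialDerivatives

variable {F : Type*} [NormedAddCommGroup F] [NormedSpace ℝ F] {L : ℝ × ℝ → F} {G : ℝ → ℝ → ℝ}

theorem hasDerivAt_mk_left (hL : Differentiable ℝ L) (s y : ℝ) :
    HasDerivAt (fun r => L (r, y)) (fderiv ℝ L (s, y) (1, 0)) s :=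
  (hL (s, y)).hasFDerivAt.comp_hasDerivAt s ((hasDerivAt_id s).prodMk (hasDerivAt_const s y))

theorem hasDerivAt_mk_right (hL : Differentiable ℝ L) (s y : ℝ) :
    HasDerivAt (fun z => L (s, z)) (fderiv ℝ L (s, y) (0, 1)) y :=
  (hL (s, y)).hasFDerivAt.comp_hasDerivAt y ((hasDerivAt_const y s).prodMk (hasDerivAt_id y))

theorem hasDerivAt_apply_const {c : ℝ → (F →L[ℝ] ℝ)} {c' : F →L[ℝ] ℝ} {s : ℝ}
    (hc : HasDerivAt c c' s) (v : F) : HasDerivAt (fun r => c r v) (c' v) s := by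
  simpa using hc.clm_apply (hasDerivAt_const s v)

theorem hasDerivAt_fst_of_differentiable (hG : Differentiable ℝ (Function.uncurry G)) (s y : ℝ) :
    HasDerivAt (fun r => G r y) (fderiv ℝ (Function.uncurry G) (s, y) (1, 0)) s :=
  hasDerivAt_mk_left hG s y

theorem hasDerivAt_snd_of_differentiable (hG : Differentiable ℝ (Function.uncurry G)) (s y : ℝ) :
    HasDerivAt (fun z => G s z) (fderiv ℝ (Function.uncurry G) (s, y) (0, 1)) y :=
  hasDerivAt_mk_right hG s y

theorem uncurry_deriv_fst_eq (hG : Differentiable ℝ (Function.uncurry G)) :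
    Function.uncurry (fun s y => deriv (fun r => G r y) s) =
      fun p => fderiv ℝ (Function.uncurry G) p (1, 0) :=
  funext fun p => (hasDerivAt_fst_of_differentiable hG p.1 p.2).deriv

theorem uncurry_deriv_snd_eq (hG : Differentiable ℝ (Function.uncurry G)) :
    Function.uncurry (fun s y => deriv (fun z => G s z) y) =
      fun p => fderiv ℝ (Function.uncurry G) p (0, 1) :=
  funext fun p => (hasDerivAt_snd_of_differentiable hG p.1 p.2).deriv

theorem contDiff_deriv_fst {m n : WithTop ℕ∞} (hG : ContDiff ℝ n (Function.uncurry G))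
    (hmn : m + 1 ≤ n) :
    ContDiff ℝ m (Function.uncurry (fun s y => deriv (fun r => G r y) s)) := by
  have hd := hG.differentiable (by rintro rfl; simp at hmn)
  rw [uncurry_deriv_fst_eq hd]
  exact (hG.fderiv_right hmn).clm_apply contDiff_const

theorem contDiff_deriv_snd {m n : WithTop ℕ∞} (hG : ContDiff ℝ n (Function.uncurry G))
    (hmn : m + 1 ≤ n) :
    ContDiff ℝ m (Function.uncurry (fun s y => deriv (fun z => G s z) y)) := by
  have hd := hG.differentiable (by rintro rfl; simp at hmn)
  rw [uncurry_deriv_snd_eq hd]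
  exact (hG.fderiv_right hmn).clm_apply contDiff_const

theorem deriv_snd_deriv_fst_comm (hG : ContDiff ℝ 2 (Function.uncurry G)) (s y : ℝ) :
    deriv (fun z => deriv (fun r => G r z) s) y = deriv (fun r => deriv (fun z => G r z) y) s := by
  have hd := hG.differentiable (by norm_num)
  have h1 : Differentiable ℝ (fderiv ℝ (Function.uncurry G)) :=
    (hG.fderiv_right (m := 1) (by norm_num)).differentiable (by norm_num)
  have hsym := hG.contDiffAt.isSymmSndFDerivAt (x := (s, y)) (by simp)
  have e1 := hasDerivAt_apply_const (hasDerivAt_mk_right h1 s y) (1, 0)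
  have e2 := hasDerivAt_apply_const (hasDerivAt_mk_left h1 s y) (0, 1)
  have f1 : (fun z => deriv (fun r => G r z) s) =
      fun z => fderiv ℝ (Function.uncurry G) (s, z) (1, 0) :=
    funext fun z => (hasDerivAt_fst_of_differentiable hd s z).deriv
  have f2 : (fun r => deriv (fun z => G r z) y) =
      fun r => fderiv ℝ (Function.uncurry G) (r, y) (0, 1) :=
    funext fun r => (hasDerivAt_snd_of_differentiable hd r y).deriv
  rw [f1, f2]
  rw [e1.deriv, e2.deriv]
  exact hsym (0, 1) (1, 0)

/-- Derivative of a function of two variables along a line. -/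
theorem hasDerivAt_along_line (hG : Differentiable ℝ (Function.uncurry G)) (s y h k τ : ℝ) :
    HasDerivAt (fun τ => G (s + τ * h) (y + τ * k))
      (deriv (fun r => G r (y + τ * k)) (s + τ * h) * h +
        deriv (fun z => G (s + τ * h) z) (y + τ * k) * k) τ := by
  have h1 : HasDerivAt (fun τ : ℝ => s + τ * h) h τ := by
    simpa using ((hasDerivAt_id τ).mul_const h).const_add s
  have h2 : HasDerivAt (fun τ : ℝ => y + τ * k) k τ := by
    simpa using ((hasDerivAt_id τ).mul_const k).const_add y
  have h3 := (hG (s + τ * h, y + τ * k)).hasFDerivAt.comp_hasDerivAt τ (h1.prodMk h2)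
  have h4 : HasDerivAt (fun τ => G (s + τ * h) (y + τ * k))
      (fderiv ℝ (Function.uncurry G) (s + τ * h, y + τ * k) (h, k)) τ := h3
  convert h4 using 1
  rw [(hasDerivAt_fst_of_differentiable hG _ _).deriv,
    (hasDerivAt_snd_of_differentiable hG _ _).deriv]
  have : ((h, k) : ℝ × ℝ) = h • ((1 : ℝ), (0 : ℝ)) + k • ((0 : ℝ), (1 : ℝ)) := by simp
  rw [this, map_add, map_smul, map_smul]
  simp [mul_comm]

theorem exists_between_sub_eq (hG : Differentiable ℝ (Function.uncurry G)) (s y s' y' : ℝ) :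
    ∃ p : ℝ × ℝ, dist p (s, y) ≤ dist (s', y') (s, y) ∧
      G s' y' - G s y = deriv (fun r => G r p.2) p.1 * (s' - s) +
        deriv (fun z => G p.1 z) p.2 * (y' - y) := by
  have hd := hasDerivAt_along_line hG s y (s' - s) (y' - y)
  obtain ⟨c, ⟨hc0, hc1⟩, hc⟩ := exists_hasDerivAt_eq_slope _ _ zero_lt_one
    (fun τ _ => (hd τ).continuousAt.continuousWithinAt) (fun τ _ => hd τ)
  refine ⟨(s + c * (s' - s), y + c * (y' - y)), ?_, ?_⟩
  · simp only [Prod.dist_eq, Real.dist_eq, add_sub_cancel_left, abs_mul, abs_of_pos hc0]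
    gcongr <;> exact mul_le_of_le_one_left (abs_nonneg _) hc1.le
  · simpa using hc.symm

theorem exists_between_taylor_two (hG : ContDiff ℝ 2 (Function.uncurry G)) (s y s' y' : ℝ) :
    ∃ p : ℝ × ℝ, dist p (s, y) ≤ dist (s', y') (s, y) ∧
      2 * (G s' y' - G s y) = 2 * (deriv (fun r => G r y) s * (s' - s) +
        deriv (fun z => G s z) y * (y' - y)) +
        (deriv (fun r => deriv (fun r => G r p.2) r) p.1 * (s' - s) ^ 2 +
        2 * deriv (fun r => deriv (fun z => G r z) p.2) p.1 * (s' - s) * (y' - y) +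
        deriv (fun z => deriv (fun z => G p.1 z) z) p.2 * (y' - y) ^ 2) := by
  set h := s' - s with hh
  set k := y' - y with hk
  have hd := hasDerivAt_along_line (hG.differentiable (by norm_num)) s y h k
  have hd1 := hasDerivAt_along_line
    ((contDiff_deriv_fst (m := 1) hG (by norm_num)).differentiable (by norm_num)) s y h k
  have hd2 := hasDerivAt_along_line
    ((contDiff_deriv_snd (m := 1) hG (by norm_num)).differentiable (by norm_num)) s y h k
  set K := G s' y' - G s y - (deriv (fun r => G r y) s * h + deriv (fun z => G s z) y * k) with hK
  set A := deriv (fun r => G r y) s * h + deriv (fun z => G s z) y * k with hA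
  have hg (τ : ℝ) : HasDerivAt (fun τ => G (s + τ * h) (y + τ * k) - G s y - A * τ - K * τ ^ 2)
      ((deriv (fun r => G r (y + τ * k)) (s + τ * h) * h +
        deriv (fun z => G (s + τ * h) z) (y + τ * k) * k) - A - 2 * K * τ) τ := by
    have := (((hd τ).sub_const (G s y)).sub ((hasDerivAt_id τ).const_mul A)).sub
      ((hasDerivAt_pow 2 τ).const_mul K)
    exact this.congr_deriv (by norm_num; ring)
  obtain ⟨c, ⟨hc0, hc1⟩, hc⟩ := exists_hasDerivAt_eq_zero zero_lt_one
    (fun τ _ => (hg τ).continuousAt.continuousWithinAt) (by simp [hK, hA, hh, hk])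
    (fun τ _ => hg τ)
  have hg' (τ : ℝ) := ((((hd1 τ).mul_const h).add ((hd2 τ).mul_const k)).sub_const A).sub
      ((hasDerivAt_id τ).const_mul (2 * K))
  obtain ⟨d, ⟨hd0, hdc⟩, hd⟩ := exists_hasDerivAt_eq_zero hc0
    (fun τ _ => (hg' τ).continuousAt.continuousWithinAt) (by
      simp only [Pi.sub_apply, Pi.add_apply, id]
      rw [hc]; simp [hA]) (fun τ _ => hg' τ)
  refine ⟨(s + d * h, y + d * k), ?_, ?_⟩
  · simp only [Prod.dist_eq, Real.dist_eq, add_sub_cancel_left, abs_mul, abs_of_pos hd0]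
    gcongr <;> exact mul_le_of_le_one_left (abs_nonneg _) (hdc.trans hc1).le
  · have hsym := deriv_snd_deriv_fst_comm hG (s + d * h) (y + d * k)
    rw [hsym] at hd
    simp only at hd ⊢
    linear_combination -hd - 2 * hK

end PartialDerivatives

section Preconnected

/-- A continuous function whose square converges along a filter with a basis of preconnected sets
converges as well. -/
theorem exists_tendsto_of_sq_tendsto {α : Type*} [TopologicalSpace α] {l : Filter α}
    {u : α → ℝ} {D : ℝ}
    (hl : ∀ S ∈ l, ∃ V ∈ l, V ⊆ S ∧ IsPreconnected V) {U : Set α} (hU : U ∈ l)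
    (hu : ContinuousOn u U) (hD : Tendsto (fun s => u s ^ 2) l (𝓝 D)) :
    ∃ L, Tendsto u l (𝓝 L) := by
  have habs : Tendsto (fun s => |u s|) l (𝓝 √D) := by
    simpa [Real.sqrt_sq_eq_abs] using hD.sqrt
  rcases eq_or_ne (√D) 0 with h0 | h0
  · exact ⟨0, (tendsto_zero_iff_abs_tendsto_zero _).2 (h0 ▸ habs)⟩
  · have hne : ∀ᶠ s in l, u s ≠ 0 := (habs.eventually_ne h0).mono fun s hs => abs_ne_zero.1 hs
    obtain ⟨V, hV, hVS, hVc⟩ := hl _ (inter_mem hU hne)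
    rcases hVc.mapsTo_Ioi_or_Iio (hu.mono fun s hs => (hVS hs).1) (fun s hs => (hVS hs).2)
      with h | h
    · exact ⟨√D, habs.congr' (eventually_of_mem hV fun s hs => abs_of_pos (h hs))⟩
    · refine ⟨-√D, habs.neg.congr' (eventually_of_mem hV fun s hs => ?_)⟩
      rw [abs_of_neg (h hs), neg_neg]

theorem exists_isPreconnected_subset_nhdsGT (t : ℝ) :
    ∀ S ∈ 𝓝[>] t, ∃ V ∈ 𝓝[>] t, V ⊆ S ∧ IsPreconnected V := fun S hS => by
  obtain ⟨u, hu, h⟩ := mem_nhdsGT_iff_exists_Ioo_subset.1 hS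
  exact ⟨_, Ioo_mem_nhdsGT hu, h, isPreconnected_Ioo⟩

theorem exists_isPreconnected_subset_nhdsLT (t : ℝ) :
    ∀ S ∈ 𝓝[<] t, ∃ V ∈ 𝓝[<] t, V ⊆ S ∧ IsPreconnected V := fun S hS => by
  obtain ⟨u, hu, h⟩ := mem_nhdsLT_iff_exists_Ioo_subset.1 hS
  exact ⟨_, Ioo_mem_nhdsLT hu, h, isPreconnected_Ioo⟩

end Preconnected

section Energy

variable {E : ℝ → ℝ → ℝ} {x : ℝ → ℝ} {T : ℝ}

theorem abs_deriv_le_one_of_isLocalMin {f : ℝ → ℝ} {a : ℝ} (hf : DifferentiableAt ℝ f a)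
    (h : IsLocalMin (fun z => f z + |z - a|) a) : |deriv f a| ≤ 1 := by
  obtain ⟨hl, hr⟩ := hasDerivAt_iff_tendsto_slope_left_right.1 hf.hasDerivAt
  have h' : ∀ᶠ z in 𝓝 a, f a ≤ f z + |z - a| := by simpa [IsLocalMin, IsMinFilter] using h
  rw [abs_le]
  constructor
  · refine ge_of_tendsto hr ?_
    filter_upwards [h'.filter_mono nhdsWithin_le_nhds, self_mem_nhdsWithin] with z hz hza
    have hpos : 0 < z - a := sub_pos.2 hza
    rw [abs_of_pos hpos] at hz
    rw [slope_def_field, le_div_iff₀ hpos]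
    linarith
  · refine le_of_tendsto hl ?_
    filter_upwards [h'.filter_mono nhdsWithin_le_nhds, self_mem_nhdsWithin] with z hz hza
    have hneg : z - a < 0 := sub_neg.2 hza
    rw [abs_of_neg hneg] at hz
    rw [slope_def_field, div_le_iff_of_neg hneg]
    linarith

/-- Where the driving force is strictly inside the elastic range, the solution is locally
constant. -/
theorem eventually_eq_of_abs_pEx_lt_one (hE : ContDiff ℝ 2 (Function.uncurry E))
    (hBV : BoundedVariationOn x (Set.Icc 0 T)) (hcont : ContinuousOn x (Set.Icc 0 T))
    (hED : EDUB E x T) {s : ℝ} (hs : s ∈ Set.Ioo 0 T) (h : |pEx E s (x s)| < 1) :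
    ∀ᶠ r in 𝓝 s, x r = x s := by
  obtain ⟨ρ, hρ, hρ1⟩ := exists_between h
  have hEd := hE.differentiable (by norm_num)
  have hEx : ContDiff ℝ 1 (Function.uncurry (pEx E)) := contDiff_deriv_snd hE (by norm_num)
  have hEt : ContDiff ℝ 1 (Function.uncurry (pEt E)) := contDiff_deriv_fst hE (by norm_num)
  have hEtx : Continuous (Function.uncurry (fun s y => deriv (fun z => pEt E s z) y)) :=
    (contDiff_deriv_snd (m := 0) hEt (by norm_num)).continuous
  set L := |deriv (fun z => pEt E s z) (x s)| + 1 with hL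
  have hL0 : 0 < L := by positivity
  have e1 : ∀ᶠ p in 𝓝 (s, x s), |Function.uncurry (pEx E) p| < ρ :=
    hEx.continuous.abs.continuousAt.eventually_lt continuousAt_const hρ
  have e2 : ∀ᶠ p in 𝓝 (s, x s),
      |Function.uncurry (fun s y => deriv (fun z => pEt E s z) y) p| < L :=
    hEtx.abs.continuousAt.eventually_lt continuousAt_const (by simp [hL])
  obtain ⟨ε, hε, hball⟩ := Metric.eventually_nhds_iff.1 (e1.and e2)
  have hball' : ∀ r ∈ Metric.ball s ε, ∀ y ∈ Metric.ball (x s) ε,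
      |pEx E r y| < ρ ∧ |deriv (fun z => pEt E r z) y| < L := fun r hr y hy =>
    hball (y := (r, y)) (by rw [Prod.dist_eq]; exact max_lt hr hy)
  have hxs : ContinuousAt x s := hcont.continuousAt (Icc_mem_nhds hs.1 hs.2)
  have e3 : ∀ᶠ r in 𝓝 s, x r ∈ Metric.ball (x s) ε := hxs (Metric.ball_mem_nhds _ hε)
  have e4 : ∀ᶠ r in 𝓝 s, r ∈ Set.Ioo 0 T := Ioo_mem_nhds hs.1 hs.2
  obtain ⟨δ, hδ, hδb⟩ := Metric.eventually_nhds_iff.1 (e3.and e4)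
  have hθ : 0 < (1 - ρ) / (2 * L) := div_pos (by linarith) (by positivity)
  set η := min (min ε δ) ((1 - ρ) / (2 * L))
  have hη : 0 < η := lt_min (lt_min hε hδ) hθ
  have key : ∀ a ∈ Metric.ball s η, ∀ b ∈ Metric.ball s η, b - a < (1 - ρ) / (2 * L) → a ≤ b →
      x b = x a := by
    intro a ha b hb hba hab
    have hsub : Set.Icc a b ⊆ Metric.ball s η := by
      rw [← segment_eq_Icc hab]
      exact (convex_ball s η).segment_subset ha hb
    have hε' : Set.Icc a b ⊆ Metric.ball s ε := hsub.trans
      (Metric.ball_subset_ball ((min_le_left _ _).trans (min_le_left _ _)))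
    have hδ' : ∀ r ∈ Set.Icc a b, x r ∈ Metric.ball (x s) ε ∧ r ∈ Set.Ioo 0 T := fun r hr =>
      hδb (Metric.ball_subset_ball ((min_le_left _ _).trans (min_le_right _ _)) (hsub hr))
    have hIcc : Set.Icc a b ⊆ Set.Icc 0 T := fun r hr => Ioo_subset_Icc_self (hδ' r hr).2
    have haI : a ∈ Set.Icc a b := left_mem_Icc.2 hab
    have hbI : b ∈ Set.Icc a b := right_mem_Icc.2 hab
    have hV : BoundedVariationOn x (Set.Icc a b) := hBV.mono hIcc
    have hdiss : ∀ r ∈ Set.Icc a b, |x r - x a| ≤ Diss x a b := fun r hr => hV.dist_le hr haI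
    have hD0 : 0 ≤ Diss x a b := ENNReal.toReal_nonneg
    have hineq := hED a b (hIcc haI).1 hab (hIcc hbI).2
    have hspace : |E b (x b) - E b (x a)| ≤ ρ * |x b - x a| :=
      (convex_ball (x s) ε).norm_image_sub_le_of_norm_deriv_le
        (fun y _ => (hasDerivAt_snd_of_differentiable hEd b y).differentiableAt)
        (fun y hy => (hball' b (hε' hbI) y hy).1.le) (hδ' a haI).1 (hδ' b hbI).1
    have hint1 : IntervalIntegrable (fun r => pEt E r (x a)) volume a b :=
      (hEt.continuous.comp (by fun_prop : Continuous fun r : ℝ => (r, x a))).intervalIntegrable _ _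
    have hint2 : IntervalIntegrable (fun r => pEt E r (x r)) volume a b := by
      refine ContinuousOn.intervalIntegrable ?_
      rw [uIcc_of_le hab]
      exact hEt.continuous.comp_continuousOn (continuousOn_id.prodMk (hcont.mono hIcc))
    have htime : ∫ r in a..b, pEt E r (x a) = E b (x a) - E a (x a) :=
      intervalIntegral.integral_eq_sub_of_hasDerivAt (fun r _ =>
        (hasDerivAt_fst_of_differentiable hEd r (x a)).differentiableAt.hasDerivAt) hint1
    have hdiff : |(∫ r in a..b, pEt E r (x r)) - ∫ r in a..b, pEt E r (x a)| ≤
        L * Diss x a b * |b - a| := by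
      rw [← intervalIntegral.integral_sub hint2 hint1]
      refine intervalIntegral.norm_integral_le_of_norm_le_const (E := ℝ) fun r hr => ?_
      have hr' : r ∈ Set.Icc a b := Ioc_subset_Icc_self (uIoc_of_le hab ▸ hr)
      refine ((convex_ball (x s) ε).norm_image_sub_le_of_norm_deriv_le (𝕜 := ℝ) (C := L)
        (fun y _ => (hasDerivAt_snd_of_differentiable (hEt.differentiable (by norm_num))
          r y).differentiableAt)
        (fun y hy => (hball' r (hε' hr') y hy).2.le) (hδ' a haI).1 (hδ' r hr').1).trans ?_
      exact mul_le_mul_of_nonneg_left (hdiss r hr') hL0.le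
    rw [abs_of_nonneg (sub_nonneg.2 hab)] at hdiff
    have hρ0 : 0 ≤ ρ := (abs_nonneg _).trans hρ.le
    have hb1 : ρ * |x b - x a| ≤ ρ * Diss x a b := mul_le_mul_of_nonneg_left (hdiss b hbI) hρ0
    have hb2 : L * (b - a) ≤ (1 - ρ) / 2 := by
      have := mul_le_mul_of_nonneg_left hba.le hL0.le
      rwa [show L * ((1 - ρ) / (2 * L)) = (1 - ρ) / 2 by field_simp] at this
    have hb3 := mul_le_mul_of_nonneg_right hb2 hD0
    have hfin : (1 - ρ) / 2 * Diss x a b ≤ 0 := by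
      linarith [neg_abs_le (E b (x b) - E b (x a)), le_abs_self
        ((∫ r in a..b, pEt E r (x r)) - ∫ r in a..b, pEt E r (x a))]
    have hDz : Diss x a b ≤ 0 := by
      by_contra! hpos
      exact absurd hfin (not_le.2 (mul_pos (by linarith) hpos))
    exact sub_eq_zero.1 (abs_eq_zero.1 (le_antisymm ((hdiss b hbI).trans hDz) (abs_nonneg _)))
  filter_upwards [Metric.ball_mem_nhds s hη] with r hr
  have hr' : |r - s| < (1 - ρ) / (2 * L) :=
    (Metric.mem_ball.1 hr).trans_le (min_le_right _ _)
  rcases le_total s r with hsr | hrs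
  · exact key s (Metric.mem_ball_self hη) r hr ((le_abs_self _).trans_lt hr') hsr
  · refine (key r hr s (Metric.mem_ball_self hη) ?_ hrs).symm
    rw [abs_sub_comm] at hr'
    exact (le_abs_self _).trans_lt hr'

/-- Away from the interior of the set where `x' = 0`, the driving force saturates. -/
theorem eventually_pEx_eq (hE : ContDiff ℝ 2 (Function.uncurry E))
    (hBV : BoundedVariationOn x (Set.Icc 0 T)) (hcont : ContinuousOn x (Set.Icc 0 T))
    (hSLS : ∀ t ∈ Set.Icc 0 T, IsLocalMin (fun z => E t z + |z - x t|) (x t))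
    (hED : EDUB E x T) {t : ℝ} (ht : t ∈ interior (Set.Icc 0 T \ interior (NullSet x T))) :
    ∀ᶠ s in 𝓝 t, pEx E s (x s) = pEx E t (x t) := by
  have hsub : interior (Set.Icc 0 T \ interior (NullSet x T)) ⊆ Set.Ioo 0 T :=
    (interior_mono sdiff_subset).trans_eq interior_Icc
  have habs : ∀ s ∈ interior (Set.Icc 0 T \ interior (NullSet x T)), |pEx E s (x s)| = 1 := by
    intro s hs
    refine le_antisymm (abs_deriv_le_one_of_isLocalMin (hasDerivAt_snd_of_differentiable
      (hE.differentiable (by norm_num)) s (x s)).differentiableAt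
      (hSLS s (Ioo_subset_Icc_self (hsub hs)))) ?_
    by_contra! hlt
    have hev := eventually_eq_of_abs_pEx_lt_one hE hBV hcont hED (hsub hs) hlt
    refine (interior_subset hs).2 (mem_interior_iff_mem_nhds.2 ?_)
    filter_upwards [hev.eventually_nhds, Ioo_mem_nhds (hsub hs).1 (hsub hs).2] with r hr hrT
    refine ⟨hrT, (hasDerivAt_const r (x s)).congr_of_eventuallyEq hr⟩
  have hxt : ContinuousAt x t := hcont.continuousAt (Icc_mem_nhds (hsub ht).1 (hsub ht).2)
  have hEx : ContDiff ℝ 1 (Function.uncurry (pEx E)) := contDiff_deriv_snd hE (by norm_num)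
  have hc : ContinuousAt (fun s => pEx E s (x s)) t :=
    ContinuousAt.comp (f := fun s => (s, x s)) hEx.continuous.continuousAt
      (continuousAt_id.prodMk hxt)
  filter_upwards [isOpen_interior.mem_nhds ht, hc (Metric.ball_mem_nhds _ one_pos)] with s hs hd
  have hd' : |pEx E s (x s) - pEx E t (x t)| < 1 := hd
  rw [abs_lt] at hd'
  rcases eq_or_eq_neg_of_abs_eq (habs s hs) with h | h <;>
    rcases eq_or_eq_neg_of_abs_eq (habs t ht) with h' | h' <;> linarith

end Energy

section QuadraticLimits

theorem tendsto_sq_of_quadratic_eq_zero {α : Type*} {l : Filter α} {a b c q : α → ℝ}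
    {a₀ b₀ c₀ : ℝ} (ha : Tendsto a l (𝓝 a₀)) (hb : Tendsto b l (𝓝 b₀)) (hc : Tendsto c l (𝓝 c₀))
    (hc₀ : c₀ ≠ 0) (h : ∀ᶠ s in l, a s + 2 * b s * q s + c s * q s ^ 2 = 0) :
    Tendsto (fun s => (c₀ * q s + b₀) ^ 2) l (𝓝 (b₀ ^ 2 - a₀ * c₀)) := by
  have hB : Tendsto (fun s => 1 + (|a s| + 2 * |b s|) / |c s|) l
      (𝓝 (1 + (|a₀| + 2 * |b₀|) / |c₀|)) :=
    ((ha.abs.add (hb.abs.const_mul 2)).div hc.abs (abs_ne_zero.2 hc₀)).const_add 1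
  have hq : IsBoundedUnder (· ≤ ·) l ((fun y => ‖y‖) ∘ q) := by
    refine hB.isBoundedUnder_le.mono_le ?_
    filter_upwards [h, hc.eventually_ne hc₀] with s hs hcs
    have hcpos : 0 < |c s| := abs_pos.2 hcs
    have hnn : 0 ≤ (|a s| + 2 * |b s|) / |c s| := by positivity
    simp only [Function.comp_apply, Real.norm_eq_abs]
    rcases le_total |q s| 1 with h1 | h1
    · linarith
    · suffices |q s| ≤ (|a s| + 2 * |b s|) / |c s| by linarith
      rw [le_div_iff₀ hcpos]
      have hqpos : 0 < |q s| := by linarith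
      have e : |c s| * |q s| ^ 2 ≤ |a s| + 2 * |b s| * |q s| := by
        have h2 : c s * q s ^ 2 = -(a s + 2 * b s * q s) := by linarith
        rw [← abs_pow, ← abs_mul, h2, abs_neg]
        refine (abs_add_le _ _).trans_eq ?_
        rw [abs_mul, abs_mul, abs_two]
      have e2 : |a s| ≤ |a s| * |q s| := le_mul_of_one_le_right (abs_nonneg _) h1
      refine le_of_mul_le_mul_right ?_ hqpos
      nlinarith
  have z1 : Tendsto (fun s => (c₀ - c s) * q s * q s) l (𝓝 0) :=
    ((by simpa using hc.const_sub c₀ : Tendsto (fun s => c₀ - c s) l (𝓝 0)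
      ).zero_mul_isBoundedUnder_le hq).zero_mul_isBoundedUnder_le hq
  have z2 : Tendsto (fun s => (b₀ - b s) * q s) l (𝓝 0) :=
    (by simpa using hb.const_sub b₀ : Tendsto (fun s => b₀ - b s) l (𝓝 0)
      ).zero_mul_isBoundedUnder_le hq
  have z3 : Tendsto (fun s => a₀ - a s) l (𝓝 0) := by simpa using ha.const_sub a₀
  have z := (((z1.add (z2.const_mul 2)).add z3).const_mul c₀).const_add (b₀ ^ 2 - a₀ * c₀)
  simp only [mul_zero, add_zero] at z
  refine z.congr' ?_
  filter_upwards [h] with s hs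
  linear_combination (-c₀) * hs

theorem eq_of_quadratic_eq_zero_of_discrim_eq_zero {a b c X : ℝ} (hc : c ≠ 0)
    (hD : b ^ 2 = a * c) (hX : a + 2 * b * X + c * X ^ 2 = 0) : X = -(b / c) := by
  have h : (c * X + b) ^ 2 = 0 := by linear_combination c * hX + hD
  have h' := pow_eq_zero_iff two_ne_zero |>.1 h
  field_simp
  linarith

end QuadraticLimits

section LevelCurves

variable {F : ℝ → ℝ → ℝ} {x : ℝ → ℝ} {t : ℝ}

theorem tendsto_of_dist_le_graph (hx : ContinuousAt x t) {ξ : ℝ → ℝ × ℝ}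
    (hξ : ∀ s, dist (ξ s) (t, x t) ≤ dist (s, x s) (t, x t)) :
    Tendsto ξ (𝓝 t) (𝓝 (t, x t)) := by
  refine tendsto_iff_dist_tendsto_zero.2
    (squeeze_zero (fun _ => dist_nonneg) hξ ?_)
  exact tendsto_iff_dist_tendsto_zero.1 (continuousAt_id.prodMk hx : ContinuousAt _ t)

theorem exists_sub_eq_along_graph (hF : ContDiff ℝ 1 (Function.uncurry F))
    (hx : ContinuousAt x t) :
    ∃ a b : ℝ → ℝ, Tendsto a (𝓝 t) (𝓝 (deriv (fun r => F r (x t)) t)) ∧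
      Tendsto b (𝓝 t) (𝓝 (deriv (fun z => F t z) (x t))) ∧
      ∀ s, F s (x s) - F t (x t) = a s * (s - t) + b s * (x s - x t) := by
  choose ξ hξ h using fun s =>
    exists_between_sub_eq (hF.differentiable (by norm_num)) t (x t) s (x s)
  have hξt := tendsto_of_dist_le_graph hx hξ
  exact ⟨_, _, ((contDiff_deriv_fst (m := 0) hF (by norm_num)).continuous.tendsto _).comp hξt,
    ((contDiff_deriv_snd (m := 0) hF (by norm_num)).continuous.tendsto _).comp hξt, h⟩

theorem exists_taylor_two_along_graph (hF : ContDiff ℝ 2 (Function.uncurry F))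
    (hx : ContinuousAt x t) :
    ∃ a b c : ℝ → ℝ,
      Tendsto a (𝓝 t) (𝓝 (deriv (fun r => deriv (fun r => F r (x t)) r) t)) ∧
      Tendsto b (𝓝 t) (𝓝 (deriv (fun r => deriv (fun z => F r z) (x t)) t)) ∧
      Tendsto c (𝓝 t) (𝓝 (deriv (fun z => deriv (fun z => F t z) z) (x t))) ∧
      ∀ s, 2 * (F s (x s) - F t (x t)) = 2 * (deriv (fun r => F r (x t)) t * (s - t) +
        deriv (fun z => F t z) (x t) * (x s - x t)) +
        (a s * (s - t) ^ 2 + 2 * b s * (s - t) * (x s - x t) + c s * (x s - x t) ^ 2) := by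
  choose ξ hξ h using fun s => exists_between_taylor_two hF t (x t) s (x s)
  have hξt := tendsto_of_dist_le_graph hx hξ
  have ht := contDiff_deriv_fst (m := 1) hF (by norm_num)
  have hy := contDiff_deriv_snd (m := 1) hF (by norm_num)
  exact ⟨_, _, _, ((contDiff_deriv_fst (m := 0) ht (by norm_num)).continuous.tendsto _).comp hξt,
    ((contDiff_deriv_fst (m := 0) hy (by norm_num)).continuous.tendsto _).comp hξt,
    ((contDiff_deriv_snd (m := 0) hy (by norm_num)).continuous.tendsto _).comp hξt, h⟩

/-- A level curve cannot cross a nondegenerate fold transversally in time. -/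
theorem deriv_fst_eq_zero_of_level (hF : ContDiff ℝ 2 (Function.uncurry F))
    (hx : ContinuousAt x t) (hlev : ∀ᶠ s in 𝓝 t, F s (x s) = F t (x t))
    (h1 : deriv (fun z => F t z) (x t) = 0)
    (h2 : deriv (fun z => deriv (fun z => F t z) z) (x t) ≠ 0) :
    deriv (fun r => F r (x t)) t = 0 := by
  obtain ⟨a, b, c, ha, hb, hc, h⟩ := exists_taylor_two_along_graph hF hx
  set c₀ := deriv (fun z => deriv (fun z => F t z) z) (x t)
  set f := deriv (fun r => F r (x t)) t
  by_contra hf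
  have hh : Tendsto (fun s => s - t) (𝓝 t) (𝓝 0) := by
    simpa using (tendsto_id (x := 𝓝 t)).sub_const t
  have hk : Tendsto (fun s => x s - x t) (𝓝 t) (𝓝 0) := by simpa using hx.tendsto.sub_const (x t)
  have hw : Tendsto (fun s => (2 * f + a s * (s - t) + 2 * b s * (x s - x t)) * c s) (𝓝 t)
      (𝓝 (2 * f * c₀)) := by
    simpa using (((ha.mul hh).const_add (2 * f)).add ((hb.const_mul 2).mul hk)).mul hc
  have hid : ∀ᶠ s in 𝓝 t,
      (s - t) * ((2 * f + a s * (s - t) + 2 * b s * (x s - x t)) * c s) =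
        -(c s * (x s - x t)) ^ 2 := by
    filter_upwards [hlev] with s hs
    have := h s
    rw [h1, hs] at this
    linear_combination (-c s) * this
  rcases lt_or_gt_of_ne (mul_ne_zero (mul_ne_zero two_ne_zero hf) h2) with hneg | hpos
  · obtain ⟨s, ⟨hw', hid'⟩, hs⟩ :=
      ((((hw.eventually_lt_const hneg).and hid).filter_mono nhdsWithin_le_nhds).and
        (self_mem_nhdsWithin (a := t) (s := Set.Iio t))).exists
    have := mul_pos_of_neg_of_neg (sub_neg.2 hs) hw'
    nlinarith [sq_nonneg (c s * (x s - x t))]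
  · obtain ⟨s, ⟨hw', hid'⟩, hs⟩ :=
      ((((hw.eventually_const_lt hpos).and hid).filter_mono nhdsWithin_le_nhds).and
        (self_mem_nhdsWithin (a := t) (s := Set.Ioi t))).exists
    have := mul_pos (sub_pos.2 hs) hw'
    nlinarith [sq_nonneg (c s * (x s - x t))]

/-- The difference quotients of a level curve through a degenerate point satisfy an approximate
quadratic equation. -/
theorem exists_quadratic_of_level (hF : ContDiff ℝ 2 (Function.uncurry F))
    (hx : ContinuousAt x t) (hlev : ∀ᶠ s in 𝓝 t, F s (x s) = F t (x t))
    (h1 : deriv (fun z => F t z) (x t) = 0)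
    (h2 : deriv (fun z => deriv (fun z => F t z) z) (x t) ≠ 0) :
    ∃ a b c : ℝ → ℝ,
      Tendsto a (𝓝 t) (𝓝 (deriv (fun r => deriv (fun r => F r (x t)) r) t)) ∧
      Tendsto b (𝓝 t) (𝓝 (deriv (fun r => deriv (fun z => F r z) (x t)) t)) ∧
      Tendsto c (𝓝 t) (𝓝 (deriv (fun z => deriv (fun z => F t z) z) (x t))) ∧
      ∀ᶠ s in 𝓝[≠] t, a s + 2 * b s * ((x s - x t) / (s - t)) +
        c s * ((x s - x t) / (s - t)) ^ 2 = 0 := by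
  have hf := deriv_fst_eq_zero_of_level hF hx hlev h1 h2
  obtain ⟨a, b, c, ha, hb, hc, h⟩ := exists_taylor_two_along_graph hF hx
  refine ⟨a, b, c, ha, hb, hc, ?_⟩
  filter_upwards [hlev.filter_mono nhdsWithin_le_nhds, self_mem_nhdsWithin] with s hs hst
  have hne : s - t ≠ 0 := sub_ne_zero.2 hst
  have := h s
  rw [h1, hf, hs] at this
  field_simp
  linear_combination -this

theorem quadratic_eq_zero_of_tendsto (hF : ContDiff ℝ 2 (Function.uncurry F))
    (hx : ContinuousAt x t) (hlev : ∀ᶠ s in 𝓝 t, F s (x s) = F t (x t))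
    (h1 : deriv (fun z => F t z) (x t) = 0)
    (h2 : deriv (fun z => deriv (fun z => F t z) z) (x t) ≠ 0)
    {l : Filter ℝ} [l.NeBot] (hl : l ≤ 𝓝[≠] t) {d : ℝ}
    (hd : Tendsto (fun s => (x s - x t) / (s - t)) l (𝓝 d)) :
    deriv (fun r => deriv (fun r => F r (x t)) r) t +
      2 * deriv (fun r => deriv (fun z => F r z) (x t)) t * d +
      deriv (fun z => deriv (fun z => F t z) z) (x t) * d ^ 2 = 0 := by
  obtain ⟨a, b, c, ha, hb, hc, h⟩ := exists_quadratic_of_level hF hx hlev h1 h2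
  have hl' : l ≤ 𝓝 t := hl.trans nhdsWithin_le_nhds
  refine tendsto_nhds_unique_of_eventuallyEq ?_ tendsto_const_nhds (h.filter_mono hl)
  exact ((ha.mono_left hl').add (((hb.mono_left hl').const_mul 2).mul hd)).add
    ((hc.mono_left hl').mul (hd.pow 2))

theorem exists_tendsto_slope_of_level (hF : ContDiff ℝ 2 (Function.uncurry F))
    (hx : ∀ᶠ s in 𝓝 t, ContinuousAt x s) (hlev : ∀ᶠ s in 𝓝 t, F s (x s) = F t (x t))
    (h1 : deriv (fun z => F t z) (x t) = 0)
    (h2 : deriv (fun z => deriv (fun z => F t z) z) (x t) ≠ 0)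
    {l : Filter ℝ} (hl : l ≤ 𝓝[≠] t)
    (hconn : ∀ S ∈ l, ∃ V ∈ l, V ⊆ S ∧ IsPreconnected V) :
    ∃ d, Tendsto (fun s => (x s - x t) / (s - t)) l (𝓝 d) := by
  obtain ⟨a, b, c, ha, hb, hc, h⟩ := exists_quadratic_of_level hF hx.self_of_nhds hlev h1 h2
  have hl' : l ≤ 𝓝 t := hl.trans nhdsWithin_le_nhds
  set b₀ := deriv (fun r => deriv (fun z => F r z) (x t)) t
  set c₀ := deriv (fun z => deriv (fun z => F t z) z) (x t)
  have hsq := tendsto_sq_of_quadratic_eq_zero (ha.mono_left hl') (hb.mono_left hl')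
    (hc.mono_left hl') h2 (h.filter_mono hl)
  have hU : {s | ContinuousAt x s ∧ s ≠ t} ∈ l :=
    inter_mem (hl' hx) (hl self_mem_nhdsWithin)
  obtain ⟨L, hL⟩ := exists_tendsto_of_sq_tendsto hconn hU (fun s hs => by
    have : s - t ≠ 0 := sub_ne_zero.2 hs.2
    have hxs := hs.1
    exact ContinuousAt.continuousWithinAt (by fun_prop (disch := assumption))) hsq
  refine ⟨(L - b₀) / c₀, ((hL.sub_const b₀).div_const c₀).congr fun s => ?_⟩
  field_simp
  ring

/-- At an accumulation point of degenerate points of a level curve the discriminant vanishes. -/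
theorem discrim_eq_zero_of_frequently (hF : ContDiff ℝ 2 (Function.uncurry F))
    (hx : ContinuousAt x t) (hlev : ∀ᶠ s in 𝓝 t, F s (x s) = F t (x t))
    (h1 : deriv (fun z => F t z) (x t) = 0)
    (h2 : deriv (fun z => deriv (fun z => F t z) z) (x t) ≠ 0)
    (hfreq : ∃ᶠ s in 𝓝[≠] t, deriv (fun z => F s z) (x s) = 0) :
    deriv (fun r => deriv (fun z => F r z) (x t)) t ^ 2 =
      deriv (fun r => deriv (fun r => F r (x t)) r) t *
      deriv (fun z => deriv (fun z => F t z) z) (x t) := by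
  obtain ⟨β, γ, hβ, hγ, h⟩ := exists_sub_eq_along_graph
    (contDiff_deriv_snd (m := 1) hF (by norm_num)) hx
  set l := 𝓝[≠] t ⊓ 𝓟 {s | deriv (fun z => F s z) (x s) = 0}
  have : l.NeBot := frequently_mem_iff_neBot.1 hfreq
  have hl : l ≤ 𝓝[≠] t := inf_le_left
  have hl' : l ≤ 𝓝 t := hl.trans nhdsWithin_le_nhds
  have hq := ((hβ.mono_left hl').div (hγ.mono_left hl') h2).neg
  have hroot := quadratic_eq_zero_of_tendsto hF hx hlev h1 h2 hl (hq.congr' (by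
    filter_upwards [(hγ.mono_left hl').eventually_ne h2, hl self_mem_nhdsWithin,
      (inf_le_right : l ≤ _) (mem_principal_self _)] with s hγs hst hs
    have hne : s - t ≠ 0 := sub_ne_zero.2 hst
    have e := h s
    rw [show deriv (fun z => F s z) (x s) = 0 from hs, h1] at e
    simp only [Pi.div_apply]
    field_simp
    linear_combination e))
  field_simp at hroot
  linear_combination -hroot

theorem tendsto_deriv_of_level (hF : ContDiff ℝ 2 (Function.uncurry F))
    (hx : ∀ᶠ s in 𝓝 t, ContinuousAt x s) (hlev : ∀ᶠ s in 𝓝 t, F s (x s) = F t (x t))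
    (h1 : deriv (fun z => F t z) (x t) = 0)
    (h2 : deriv (fun z => deriv (fun z => F t z) z) (x t) ≠ 0)
    {l : Filter ℝ} [l.NeBot] (hl : l ≤ 𝓝[≠] t) {d : ℝ}
    (hd : Tendsto (fun s => (x s - x t) / (s - t)) l (𝓝 d))
    (hne : deriv (fun r => deriv (fun z => F r z) (x t)) t +
      deriv (fun z => deriv (fun z => F t z) z) (x t) * d ≠ 0) :
    Tendsto (deriv x) l (𝓝 d) := by
  have hl' : l ≤ 𝓝 t := hl.trans nhdsWithin_le_nhds
  have hf := deriv_fst_eq_zero_of_level hF hx.self_of_nhds hlev h1 h2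
  have hroot := quadratic_eq_zero_of_tendsto hF hx.self_of_nhds hlev h1 h2 hl hd
  obtain ⟨β, γ, hβ, hγ, hβγ⟩ := exists_sub_eq_along_graph
    (contDiff_deriv_snd (m := 1) hF (by norm_num)) hx.self_of_nhds
  obtain ⟨α, δ, hα, hδ, hαδ⟩ := exists_sub_eq_along_graph
    (contDiff_deriv_fst (m := 1) hF (by norm_num)) hx.self_of_nhds
  rw [deriv_snd_deriv_fst_comm hF] at hδ
  set a₀ := deriv (fun r => deriv (fun r => F r (x t)) r) t
  set b₀ := deriv (fun r => deriv (fun z => F r z) (x t)) t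
  set c₀ := deriv (fun z => deriv (fun z => F t z) z) (x t)
  have hden := (hβ.mono_left hl').add ((hγ.mono_left hl').mul hd)
  have hnum := (hα.mono_left hl').add ((hδ.mono_left hl').mul hd)
  have hlim := (hnum.div hden hne).neg
  have hd' : -((a₀ + b₀ * d) / (b₀ + c₀ * d)) = d := by
    rw [neg_eq_iff_eq_neg, div_eq_iff hne]
    linear_combination hroot
  rw [hd'] at hlim
  refine hlim.congr' ?_
  filter_upwards [hden.eventually_ne hne, hl self_mem_nhdsWithin, hl' hx,
    hl' hlev.eventually_nhds] with s hs hst hxs hlevs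
  have hst' : s - t ≠ 0 := sub_ne_zero.2 hst
  have eβ := hβγ s
  have eα := hαδ s
  rw [h1, sub_zero] at eβ
  rw [hf, sub_zero] at eα
  have eβ' : deriv (fun z => F s z) (x s) =
      (s - t) * (β s + γ s * ((x s - x t) / (s - t))) := by
    rw [eβ]; field_simp
  have eα' : deriv (fun r => F r (x s)) s =
      (s - t) * (α s + δ s * ((x s - x t) / (s - t))) := by
    rw [eα]; field_simp
  have hFx : deriv (fun z => F s z) (x s) ≠ 0 := eβ' ▸ mul_ne_zero hst' hs
  obtain ⟨p, q, hp, hq, hpq⟩ := exists_sub_eq_along_graph (hF.of_le (by norm_num)) hxs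
  have hslope : HasDerivAt x (-(deriv (fun r => F r (x s)) s / deriv (fun z => F s z) (x s))) s := by
    rw [hasDerivAt_iff_tendsto_slope]
    refine ((hp.div hq hFx).neg.mono_left nhdsWithin_le_nhds).congr' ?_
    filter_upwards [(hq.eventually_ne hFx).filter_mono nhdsWithin_le_nhds, self_mem_nhdsWithin,
      hlevs.filter_mono nhdsWithin_le_nhds] with r hqr hrs hr
    have hrs' : r - s ≠ 0 := sub_ne_zero.2 hrs
    have e := hpq r
    rw [hr, hlevs.self_of_nhds, sub_self] at e
    rw [slope_def_field]
    simp only [Pi.div_apply]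
    field_simp
    linear_combination e
  rw [hslope.deriv, eβ', eα', mul_div_mul_left _ _ hst']
  rfl

end LevelCurves

/-- for continuous `x` with strong local stability and the energy-dissipation
upper bound, if `t ∈ int([0,T] ∖ int(N))`, `∂ₓₓ𝓔(t,x(t)) = 0` and `∂ₓₓₓ𝓔(t,x(t)) ≠ 0`,
then the one-sided derivatives exist and solve the quadratic
`∂ₓₜₜ𝓔 + 2∂ₓₓₜ𝓔·X + ∂ₓₓₓ𝓔·X² = 0`; if `t` is an accumulation point of
`E = {s ∈ (0,T) : ∂ₓₓ𝓔(s,x(s)) = 0}` then `x'(t) = −∂ₓₓₜ𝓔/∂ₓₓₓ𝓔` is the unique solution,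
while if `t` is an isolated point of `E`, either `x'(t) = −∂ₓₓₜ𝓔/∂ₓₓₓ𝓔` or
`x'₊(t) = lim_{s↓t} x'(s)` and `x'₋(t) = lim_{s↑t} x'(s)`. -/
theorem one_sided_derivatives_at_degenerate_point
    (T : ℝ) (hT : 0 < T) (E : ℝ → ℝ → ℝ)
    (hE : ContDiff ℝ 3 (Function.uncurry E))
    (x : ℝ → ℝ) (hBV : BoundedVariationOn x (Set.Icc 0 T))
    (hcont : ContinuousOn x (Set.Icc 0 T))
    (hSLS : ∀ t ∈ Set.Icc 0 T, IsLocalMin (fun z => E t z + |z - x t|) (x t))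
    (hED : EDUB E x T)
    (t : ℝ) (ht : t ∈ interior (Set.Icc 0 T \ interior (NullSet x T)))
    (h1 : pExx E t (x t) = 0) (h2 : pExxx E t (x t) ≠ 0) :
    ∃ dp dm : ℝ,
      Filter.Tendsto (fun s => (x s - x t) / (s - t)) (𝓝[>] t) (𝓝 dp) ∧
      Filter.Tendsto (fun s => (x s - x t) / (s - t)) (𝓝[<] t) (𝓝 dm) ∧
      pExtt E t (x t) + 2 * pExxt E t (x t) * dp + pExxx E t (x t) * dp ^ 2 = 0 ∧
      pExtt E t (x t) + 2 * pExxt E t (x t) * dm + pExxx E t (x t) * dm ^ 2 = 0 ∧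
      (AccPt t (𝓟 {s | s ∈ Set.Ioo 0 T ∧ pExx E s (x s) = 0}) →
        HasDerivAt x (-(pExxt E t (x t) / pExxx E t (x t))) t ∧
        ∀ X : ℝ, pExtt E t (x t) + 2 * pExxt E t (x t) * X + pExxx E t (x t) * X ^ 2 = 0 →
          X = -(pExxt E t (x t) / pExxx E t (x t))) ∧
      ((t ∈ Set.Ioo 0 T ∧ ∃ ε > (0:ℝ), ∀ s ∈ Set.Ioo 0 T,
          pExx E s (x s) = 0 → |s - t| < ε → s = t) →
        (HasDerivAt x (-(pExxt E t (x t) / pExxx E t (x t))) t ∨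
         (Filter.Tendsto (deriv x) (𝓝[>] t) (𝓝 dp) ∧
          Filter.Tendsto (deriv x) (𝓝[<] t) (𝓝 dm)))) := by
  have hE2 : ContDiff ℝ 2 (Function.uncurry E) := hE.of_le (by norm_num)
  have hF : ContDiff ℝ 2 (Function.uncurry (pEx E)) := contDiff_deriv_snd hE (by norm_num)
  have hlev := eventually_pEx_eq hE2 hBV hcont hSLS hED ht
  have htT : t ∈ Set.Ioo 0 T := by
    rw [← interior_Icc]
    exact interior_mono sdiff_subset ht
  have hx : ∀ᶠ s in 𝓝 t, ContinuousAt x s := by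
    filter_upwards [Ioo_mem_nhds htT.1 htT.2] with s hs
    exact hcont.continuousAt (Icc_mem_nhds hs.1 hs.2)
  have hgt : 𝓝[>] t ≤ 𝓝[≠] t := nhdsWithin_mono t fun s hs => ne_of_gt hs
  have hlt : 𝓝[<] t ≤ 𝓝[≠] t := nhdsWithin_mono t fun s hs => ne_of_lt hs
  obtain ⟨dp, hdp⟩ := exists_tendsto_slope_of_level hF hx hlev h1 h2 hgt
    (exists_isPreconnected_subset_nhdsGT t)
  obtain ⟨dm, hdm⟩ := exists_tendsto_slope_of_level hF hx hlev h1 h2 hlt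
    (exists_isPreconnected_subset_nhdsLT t)
  have hp : pExtt E t (x t) + 2 * pExxt E t (x t) * dp + pExxx E t (x t) * dp ^ 2 = 0 :=
    quadratic_eq_zero_of_tendsto hF hx.self_of_nhds hlev h1 h2 hgt hdp
  have hm : pExtt E t (x t) + 2 * pExxt E t (x t) * dm + pExxx E t (x t) * dm ^ 2 = 0 :=
    quadratic_eq_zero_of_tendsto hF hx.self_of_nhds hlev h1 h2 hlt hdm
  have hdouble : pExxt E t (x t) ^ 2 = pExtt E t (x t) * pExxx E t (x t) →
      HasDerivAt x (-(pExxt E t (x t) / pExxx E t (x t))) t := by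
    intro hD
    have ep := eq_of_quadratic_eq_zero_of_discrim_eq_zero h2 hD hp
    have em := eq_of_quadratic_eq_zero_of_discrim_eq_zero h2 hD hm
    refine hasDerivAt_iff_tendsto_slope_left_right.2 ⟨?_, ?_⟩
    · simpa only [slope_fun_def_field, em] using hdm
    · simpa only [slope_fun_def_field, ep] using hdp
  refine ⟨dp, dm, hdp, hdm, hp, hm, fun hacc => ?_, fun _ => ?_⟩
  · have hD : pExxt E t (x t) ^ 2 = pExtt E t (x t) * pExxx E t (x t) :=
      discrim_eq_zero_of_frequently hF hx.self_of_nhds hlev h1 h2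
        ((accPt_iff_frequently_nhdsNE.1 hacc).mono fun s hs => hs.2)
    exact ⟨hdouble hD, fun X hX => eq_of_quadratic_eq_zero_of_discrim_eq_zero h2 hD hX⟩
  · by_cases hD : pExxt E t (x t) ^ 2 = pExtt E t (x t) * pExxx E t (x t)
    · exact Or.inl (hdouble hD)
    · have hsimple : ∀ X : ℝ,
          pExtt E t (x t) + 2 * pExxt E t (x t) * X + pExxx E t (x t) * X ^ 2 = 0 →
          pExxt E t (x t) + pExxx E t (x t) * X ≠ 0 := fun X hX h0 => hD (by
        linear_combination (pExxt E t (x t) + pExxx E t (x t) * X) * h0 - pExxx E t (x t) * hX)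
      exact Or.inr ⟨tendsto_deriv_of_level hF hx hlev h1 h2 hgt hdp (hsimple dp hp),
        tendsto_deriv_of_level hF hx hlev h1 h2 hlt hdm (hsimple dm hm)⟩
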